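/- Let (xₙ) and (x'ₙ) be sequences in a metric space (X,d) and r > 0 with d(xₙ, x'ₙ) ≥ r for every n ∈ ℕ. Then there exists a strictly increasing sequence (n_k) of indices such that, setting A = {x_{n_k} : k ∈ ℕ} and A' = {x'_{n_k} : k ∈ ℕ}, one has d(a, a') ≥ r/3 for every a ∈ A and a' ∈ A' (i.e., d(A, A') ≥ r/3). -/

import Mathlib

open Set Metric Topology Filter

/-- A relation on `ℕ` that each index eventually satisfies holds between the terms of some
strictly increasing sequence. -/
lemma exists_strictMono_pairwise_of_eventually {R : ℕ → ℕ → Prop}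
    (hR : ∀ n, ∀ᶠ m in atTop, R n m) :
    ∃ φ : ℕ → ℕ, StrictMono φ ∧ ∀ k l, k < l → R (φ k) (φ l) := by
  obtain ⟨φ, -, hφ⟩ := exists_seq_of_forall_finset_exists (fun _ => True)
    (fun n m => n < m ∧ R n m) fun s _ => by
      have hs : ∀ᶠ m in atTop, ∀ n ∈ s, n < m ∧ R n m :=
        (Filter.eventually_all_finset s).2 fun n _ => (eventually_gt_atTop n).and (hR n)
      obtain ⟨m, hm⟩ := hs.exists
      exact ⟨m, trivial, hm⟩
  exact ⟨φ, fun k l hkl => (hφ k l hkl).1, fun k l hkl => (hφ k l hkl).2⟩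

/-- If infinitely many `x n` lie within `r / 3` of a fixed point, then along these indices the
ranges of `x` and `x'` are at distance at least `r / 3`. -/
lemma exists_subsequences_of_frequently_dist_lt {X : Type*} [PseudoMetricSpace X] {x x' : ℕ → X}
    {r : ℝ} (h : ∀ n, r ≤ dist (x n) (x' n)) {p : X}
    (hp : ∃ᶠ n in atTop, dist (x n) p < r / 3) :
    ∃ φ : ℕ → ℕ, StrictMono φ ∧ ∀ k l : ℕ, r / 3 ≤ dist (x (φ k)) (x' (φ l)) := by
  obtain ⟨φ, hφ, hd⟩ := extraction_of_frequently_atTop hp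
  refine ⟨φ, hφ, fun k l => ?_⟩
  have h₁ := dist_triangle (x (φ l)) (x (φ k)) (x' (φ l))
  have h₂ := dist_triangle_right (x (φ l)) (x (φ k)) p
  linarith [h (φ l), hd k, hd l]

/-- Given sequences with `dist (x n) (x' n) ≥ r`, one can pass to common subsequences whose
ranges `A`, `A'` satisfy `dist (A, A') ≥ r / 3`. -/
theorem exists_subsequences_dist_ge_third
    {X : Type*} [MetricSpace X] (x x' : ℕ → X) (r : ℝ) (hr : 0 < r)
    (h : ∀ n : ℕ, r ≤ dist (x n) (x' n)) :
    ∃ φ : ℕ → ℕ, StrictMono φ ∧ ∀ k l : ℕ, r / 3 ≤ dist (x (φ k)) (x' (φ l)) := by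
  by_cases hx : ∃ p, ∃ᶠ n in atTop, dist (x n) p < r / 3
  · obtain ⟨p, hp⟩ := hx
    exact exists_subsequences_of_frequently_dist_lt h hp
  by_cases hx' : ∃ p, ∃ᶠ n in atTop, dist (x' n) p < r / 3
  · obtain ⟨p, hp⟩ := hx'
    obtain ⟨φ, hφ, hd⟩ := exists_subsequences_of_frequently_dist_lt
      (fun n => (h n).trans_eq (dist_comm _ _)) hp
    exact ⟨φ, hφ, fun k l => (hd l k).trans_eq (dist_comm _ _)⟩
  simp only [not_exists, not_frequently, not_lt] at hx hx'
  obtain ⟨φ, hφ, hd⟩ := exists_strictMono_pairwise_of_eventually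
    fun n => (hx (x' n)).and (hx' (x n))
  refine ⟨φ, hφ, fun k l => ?_⟩
  rcases lt_trichotomy k l with hkl | rfl | hlk
  · exact (hd k l hkl).2.trans_eq (dist_comm _ _)
  · linarith [h (φ k)]
  · exact (hd l k hlk).1
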